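/- Let Ω ⊂ ℝ^n (n ≥ 2) be a bounded open set admitting a Green function G, and let a, b ∈ Ω be distinct. Assume that for c ∈ {a,b} the function G(·,c) extends to a continuously differentiable function on cl(Ω) \ {c}, and that the function x ↦ ⟨∇_x G(x,a), ∇_x G(x,b)⟩ is integrable on Ω. Then the Green function is represented as a mutual energy: G(a,b) = ∫_Ω ⟨∇_x G(x,a), ∇_x G(x,b)⟩ dx. -/

import Mathlib

open MeasureTheory
open scoped BigOperators

/-- The partial derivative `∂f/∂xᵢ` of a function on Euclidean space. -/
noncomputable def pd {n : ℕ} (f : EuclideanSpace ℝ (Fin n) → ℝ) (i : Fin n)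
    (x : EuclideanSpace ℝ (Fin n)) : ℝ :=
  fderiv ℝ f x (EuclideanSpace.single i 1)

/-- The Laplacian `Δf = ∑ᵢ ∂²f/∂xᵢ²`. -/
noncomputable def lap {n : ℕ} (f : EuclideanSpace ℝ (Fin n) → ℝ)
    (x : EuclideanSpace ℝ (Fin n)) : ℝ :=
  ∑ i, pd (pd f i) i x

/-- `G` is a Green function for the (bounded, open) set `Ω ⊆ ℝ^n`: for each pole `a ∈ Ω`,
`G(·,a)` is smooth off the pole and locally integrable, satisfies `−ΔG(·,a) = δ_a` in the
distributional sense, and extends continuously to `cl(Ω) \ {a}` with value `0` on `∂Ω`. -/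
structure IsGreen (n : ℕ) (Ω : Set (EuclideanSpace ℝ (Fin n)))
    (G : EuclideanSpace ℝ (Fin n) → EuclideanSpace ℝ (Fin n) → ℝ) : Prop where
  smooth : ∀ a ∈ Ω, ContDiffOn ℝ (⊤ : ℕ∞) (fun x => G x a) (Ω \ {a})
  locInt : ∀ a ∈ Ω, LocallyIntegrableOn (fun x => G x a) Ω volume
  distrib : ∀ a ∈ Ω, ∀ φ : EuclideanSpace ℝ (Fin n) → ℝ,
      ContDiff ℝ (⊤ : ℕ∞) φ → HasCompactSupport φ → tsupport φ ⊆ Ω →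
      (∫ x in Ω, G x a * lap φ x) = -φ a
  boundary : ∀ a ∈ Ω, ∃ Gbar : EuclideanSpace ℝ (Fin n) → ℝ,
      ContinuousOn Gbar (closure Ω \ {a}) ∧
      (∀ x ∈ Ω \ {a}, Gbar x = G x a) ∧
      (∀ x ∈ frontier Ω, Gbar x = 0)


open Filter Topology
open scoped ContDiff

section Calculus

variable {n : ℕ}

/-- The pointwise inner product `⟨∇f, ∇g⟩` of two gradients. -/
noncomputable def gradInner (f g : EuclideanSpace ℝ (Fin n) → ℝ)
    (x : EuclideanSpace ℝ (Fin n)) : ℝ :=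
  ∑ i, pd f i x * pd g i x

variable {f g h w : EuclideanSpace ℝ (Fin n) → ℝ} {x : EuclideanSpace ℝ (Fin n)} {i : Fin n}

theorem gradInner_comm (f g : EuclideanSpace ℝ (Fin n) → ℝ) (x : EuclideanSpace ℝ (Fin n)) :
    gradInner f g x = gradInner g f x := by
  simp only [gradInner, mul_comm]

theorem pd_congr (hfg : f =ᶠ[𝓝 x] g) (i : Fin n) : pd f i x = pd g i x := by
  simp only [pd, hfg.fderiv_eq]

theorem pd_eventuallyEq (hfg : f =ᶠ[𝓝 x] g) (i : Fin n) : pd f i =ᶠ[𝓝 x] pd g i :=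
  hfg.eventuallyEq_nhds.mono fun _ hy => pd_congr hy i

theorem gradInner_congr_left (hfg : f =ᶠ[𝓝 x] g) (h : EuclideanSpace ℝ (Fin n) → ℝ) :
    gradInner f h x = gradInner g h x := by
  simp only [gradInner, pd_congr hfg]

theorem gradInner_congr_right (hfg : f =ᶠ[𝓝 x] g) (h : EuclideanSpace ℝ (Fin n) → ℝ) :
    gradInner h f x = gradInner h g x := by
  simp only [gradInner, pd_congr hfg]

@[simp]
theorem pd_const (c : ℝ) (i : Fin n) (x : EuclideanSpace ℝ (Fin n)) :
    pd (fun _ => c) i x = 0 := by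
  simp [pd]

theorem pd_add (hf : DifferentiableAt ℝ f x) (hg : DifferentiableAt ℝ g x) :
    pd (fun y => f y + g y) i x = pd f i x + pd g i x := by
  simp [pd, fderiv_fun_add hf hg]

theorem pd_sub (hf : DifferentiableAt ℝ f x) (hg : DifferentiableAt ℝ g x) :
    pd (fun y => f y - g y) i x = pd f i x - pd g i x := by
  simp [pd, fderiv_fun_sub hf hg]

theorem pd_mul (hf : DifferentiableAt ℝ f x) (hg : DifferentiableAt ℝ g x) :
    pd (fun y => f y * g y) i x = f x * pd g i x + g x * pd f i x := by
  simp [pd, fderiv_fun_mul hf hg]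

theorem pd_comp {φ : ℝ → ℝ} (hφ : DifferentiableAt ℝ φ (f x)) (hf : DifferentiableAt ℝ f x) :
    pd (fun y => φ (f y)) i x = deriv φ (f x) * pd f i x := by
  have := (hφ.hasDerivAt.comp_hasFDerivAt x hf.hasFDerivAt).fderiv
  simp only [pd]
  change fderiv ℝ (φ ∘ f) x _ = _
  rw [this]
  simp

theorem ContDiffAt.pd (hf : ContDiffAt ℝ ∞ f x) (i : Fin n) : ContDiffAt ℝ ∞ (pd f i) x := by
  have : ContDiffAt ℝ ∞ (fderiv ℝ f) x := hf.fderiv_right (by simp)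
  exact this.clm_apply contDiffAt_const

theorem ContDiff.pd (hf : ContDiff ℝ ∞ f) (i : Fin n) : ContDiff ℝ ∞ (pd f i) :=
  contDiff_iff_contDiffAt.2 fun _ => hf.contDiffAt.pd i

theorem ContDiffAt.gradInner (hf : ContDiffAt ℝ ∞ f x) (hg : ContDiffAt ℝ ∞ g x) :
    ContDiffAt ℝ ∞ (gradInner f g) x :=
  ContDiffAt.sum fun i _ => (hf.pd i).mul (hg.pd i)

theorem ContDiffAt.lap (hf : ContDiffAt ℝ ∞ f x) : ContDiffAt ℝ ∞ (lap f) x :=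
  ContDiffAt.sum fun i _ => (hf.pd i).pd i

theorem ContDiffAt.differentiableAt_of_infty (hf : ContDiffAt ℝ ∞ f x) :
    DifferentiableAt ℝ f x :=
  hf.differentiableAt (by simp)

theorem ContDiffAt.eventually_differentiableAt (hf : ContDiffAt ℝ ∞ f x) :
    ∀ᶠ y in 𝓝 x, DifferentiableAt ℝ f y :=
  ((hf.of_le (m := 1) (by simp)).eventually (by simp)).mono fun _ hy =>
    hy.differentiableAt one_ne_zero

theorem gradInner_mul_left (hf : ContDiffAt ℝ ∞ f x) (hg : ContDiffAt ℝ ∞ g x)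
    (h : EuclideanSpace ℝ (Fin n) → ℝ) :
    gradInner (fun y => f y * g y) h x = f x * gradInner g h x + g x * gradInner f h x := by
  simp only [gradInner, pd_mul hf.differentiableAt_of_infty hg.differentiableAt_of_infty,
    Finset.mul_sum, ← Finset.sum_add_distrib]
  exact Finset.sum_congr rfl fun i _ => by ring

theorem lap_mul (hf : ContDiffAt ℝ ∞ f x) (hg : ContDiffAt ℝ ∞ g x) :
    lap (fun y => f y * g y) x = f x * lap g x + 2 * gradInner f g x + g x * lap f x := by
  have key (i : Fin n) : pd (pd (fun y => f y * g y) i) i x =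
      f x * pd (pd g i) i x + 2 * (pd f i x * pd g i x) + g x * pd (pd f i) i x := by
    have h1 : pd (fun y => f y * g y) i =ᶠ[𝓝 x] fun y => f y * pd g i y + g y * pd f i y := by
      filter_upwards [hf.eventually_differentiableAt, hg.eventually_differentiableAt]
        with y hy hy'
      exact pd_mul hy hy'
    rw [pd_congr h1, pd_add (hf.mul (hg.pd i)).differentiableAt_of_infty
      (hg.mul (hf.pd i)).differentiableAt_of_infty,
      pd_mul hf.differentiableAt_of_infty (hg.pd i).differentiableAt_of_infty,
      pd_mul hg.differentiableAt_of_infty (hf.pd i).differentiableAt_of_infty]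
    ring
  simp only [lap, gradInner, key, Finset.sum_add_distrib, Finset.mul_sum]

theorem pd_eq_zero_of_notMem_tsupport (hx : x ∉ tsupport f) : pd f i x = 0 := by
  rw [pd_congr (notMem_tsupport_iff_eventuallyEq.1 hx) i]
  exact pd_const 0 i x

theorem gradInner_eq_zero_of_notMem_tsupport (hx : x ∉ tsupport f)
    (g : EuclideanSpace ℝ (Fin n) → ℝ) : gradInner f g x = 0 :=
  Finset.sum_eq_zero fun i _ => by rw [pd_eq_zero_of_notMem_tsupport hx, zero_mul]

theorem tsupport_pd_subset (f : EuclideanSpace ℝ (Fin n) → ℝ) (i : Fin n) :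
    tsupport (pd f i) ⊆ tsupport f :=
  closure_minimal (fun x hx => by
    by_contra h
    exact hx (pd_eq_zero_of_notMem_tsupport h)) isClosed_closure

theorem lap_eq_zero_of_notMem_tsupport (hx : x ∉ tsupport f) : lap f x = 0 :=
  Finset.sum_eq_zero fun i _ =>
    pd_eq_zero_of_notMem_tsupport fun h => hx (tsupport_pd_subset f i h)

theorem contDiff_mul_of_tsupport (hw : ContDiff ℝ ∞ w)
    (hf : ∀ x ∈ tsupport w, ContDiffAt ℝ ∞ f x) : ContDiff ℝ ∞ fun x => w x * f x := by
  refine contDiff_iff_contDiffAt.2 fun x => ?_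
  by_cases hx : x ∈ tsupport w
  · exact hw.contDiffAt.mul (hf x hx)
  · refine contDiffAt_const (c := (0 : ℝ)) |>.congr_of_eventuallyEq ?_
    filter_upwards [notMem_tsupport_iff_eventuallyEq.1 hx] with y hy
    simp [hy]

theorem integrable_mul_of_tsupport (hw : ContDiff ℝ ∞ w) (hwc : HasCompactSupport w)
    (hf : ∀ x ∈ tsupport w, ContDiffAt ℝ ∞ f x) : Integrable fun x => w x * f x :=
  (contDiff_mul_of_tsupport hw hf).continuous.integrable_of_hasCompactSupport hwc.mul_right

theorem integral_pd_eq_zero (hw : ContDiff ℝ ∞ w) (hwc : HasCompactSupport w) (i : Fin n) :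
    ∫ x, pd w i x = 0 := by
  have hpc : HasCompactSupport (pd w i) :=
    hwc.mono' (tsupport_pd_subset w i |>.trans' subset_closure)
  have := integral_bilinear_hasLineDerivAt_right_eq_neg_left_of_integrable
    (μ := (volume : Measure (EuclideanSpace ℝ (Fin n)))) (f := fun _ => (1 : ℝ))
    (f' := fun _ => (0 : ℝ)) (g := w) (g' := pd w i) (v := EuclideanSpace.single i 1)
    (B := ContinuousLinearMap.mul ℝ ℝ) (by simp)
    (by simpa using (hw.pd i).continuous.integrable_of_hasCompactSupport hpc)
    (by simpa using hw.continuous.integrable_of_hasCompactSupport hwc)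
    (fun x _ => by simpa using (hasFDerivAt_const (1 : ℝ) x).hasLineDerivAt _)
    (fun x _ => hw.contDiffAt.differentiableAt_of_infty.hasFDerivAt.hasLineDerivAt _)
  simpa using this

theorem integral_mul_lap_left (hw : ContDiff ℝ ∞ w) (hwc : ∀ i, HasCompactSupport (pd w i))
    (hf : ∀ i, ∀ x ∈ tsupport (pd w i), ContDiffAt ℝ ∞ f x) :
    ∫ x, lap w x * f x = -∫ x, gradInner w f x := by
  have h1 (i : Fin n) : Integrable fun x => pd (pd w i) i x * f x :=
    integrable_mul_of_tsupport ((hw.pd i).pd i)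
      ((hwc i).mono' (tsupport_pd_subset _ i |>.trans' subset_closure))
      fun x hx => hf i x (tsupport_pd_subset _ i hx)
  have h2 (i : Fin n) : Integrable fun x => pd w i x * pd f i x :=
    integrable_mul_of_tsupport (hw.pd i) (hwc i) fun x hx => (hf i x hx).pd i
  simp only [lap, gradInner, Finset.sum_mul]
  rw [integral_finsetSum _ fun i _ => h1 i, integral_finsetSum _ fun i _ => h2 i,
    ← Finset.sum_neg_distrib]
  refine Finset.sum_congr rfl fun i _ => eq_neg_of_add_eq_zero_left ?_
  rw [← integral_add (h1 i) (h2 i),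
    ← integral_pd_eq_zero (contDiff_mul_of_tsupport (hw.pd i) (hf i)) (hwc i).mul_right i]
  refine integral_congr_ae (Eventually.of_forall fun x => ?_)
  by_cases hx : x ∈ tsupport (pd w i)
  · simp only [pd_mul (hw.pd i).contDiffAt.differentiableAt_of_infty
      (hf i x hx).differentiableAt_of_infty]
    ring
  · have h3 : pd (fun y => pd w i y * f y) i x = 0 :=
      pd_eq_zero_of_notMem_tsupport fun h => hx (tsupport_mul_subset_left h)
    simp only [h3, pd_eq_zero_of_notMem_tsupport hx, image_eq_zero_of_notMem_tsupport hx]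
    simp

theorem integral_mul_lap_right (hw : ContDiff ℝ ∞ w) (hwc : HasCompactSupport w)
    (hf : ∀ x ∈ tsupport w, ContDiffAt ℝ ∞ f x) :
    ∫ x, w x * lap f x = -∫ x, gradInner w f x := by
  have h1 (i : Fin n) : Integrable fun x => w x * pd (pd f i) i x :=
    integrable_mul_of_tsupport hw hwc fun x hx => ((hf x hx).pd i).pd i
  have h2 (i : Fin n) : Integrable fun x => pd w i x * pd f i x :=
    integrable_mul_of_tsupport (hw.pd i)
      (hwc.mono' (tsupport_pd_subset _ i |>.trans' subset_closure))
      fun x hx => (hf x (tsupport_pd_subset _ i hx)).pd i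
  simp only [lap, gradInner, Finset.mul_sum]
  rw [integral_finsetSum _ fun i _ => h1 i, integral_finsetSum _ fun i _ => h2 i,
    ← Finset.sum_neg_distrib]
  refine Finset.sum_congr rfl fun i _ => eq_neg_of_add_eq_zero_left ?_
  rw [← integral_add (h1 i) (h2 i), ← integral_pd_eq_zero
    (contDiff_mul_of_tsupport hw fun x hx => (hf x hx).pd i) hwc.mul_right i]
  refine integral_congr_ae (Eventually.of_forall fun x => ?_)
  by_cases hx : x ∈ tsupport w
  · simp only [pd_mul hw.contDiffAt.differentiableAt_of_infty
      ((hf x hx).pd i).differentiableAt_of_infty]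
    ring
  · have h3 : pd (fun y => w y * pd f i y) i x = 0 :=
      pd_eq_zero_of_notMem_tsupport fun h => hx (tsupport_mul_subset_left h)
    simp only [h3, pd_eq_zero_of_notMem_tsupport hx, image_eq_zero_of_notMem_tsupport hx]
    simp

/-- The gradient of a function vanishes almost everywhere on its zero set. -/
theorem ae_pd_eq_zero_of_eq_zero {s : Set (EuclideanSpace ℝ (Fin n))} (hs : MeasurableSet s)
    (hf : ∀ x ∈ s, DifferentiableAt ℝ f x) (h0 : ∀ x ∈ s, f x = 0) (i : Fin n) :
    ∀ᵐ x ∂volume.restrict s, pd f i x = 0 := by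
  set v : EuclideanSpace ℝ (Fin n) := EuclideanSpace.single i 1
  have hA : ApproximatesLinearOn (fun x => f x • v) (0 : EuclideanSpace ℝ (Fin n) →L[ℝ] _) s 0 := by
    intro x hx y hy
    simp [h0 x hx, h0 y hy]
  filter_upwards [hA.norm_fderiv_sub_le volume hs (fun x => (fderiv ℝ f x).smulRight v)
    fun x hx => ((hf x hx).hasFDerivAt.smul_const v).hasFDerivWithinAt] with x hx
  have hv : v ≠ 0 := by simp [v]
  have h1 : fderiv ℝ f x = 0 := by simpa [hv] using hx
  simp [pd, h1]

end Calculus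

section RadialCutoff

variable {n : ℕ}

theorem contDiff_radial {φ : ℝ → ℝ} (hφ : ContDiff ℝ ∞ φ) (t : ℝ)
    (a : EuclideanSpace ℝ (Fin n)) :
    ContDiff ℝ ∞ fun x : EuclideanSpace ℝ (Fin n) => φ (t * ‖x - a‖ ^ 2) :=
  hφ.comp (contDiff_const.mul ((contDiff_id.sub contDiff_const).norm_sq ℝ))

theorem contDiff_coord_sub (a : EuclideanSpace ℝ (Fin n)) (i : Fin n) :
    ContDiff ℝ ∞ fun x : EuclideanSpace ℝ (Fin n) => x i - a i :=
  (EuclideanSpace.proj (𝕜 := ℝ) i : EuclideanSpace ℝ (Fin n) →L[ℝ] ℝ).contDiff.sub contDiff_const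

theorem pd_coord_sub (a x : EuclideanSpace ℝ (Fin n)) (i j : Fin n) :
    pd (fun y : EuclideanSpace ℝ (Fin n) => y i - a i) j x = if i = j then 1 else 0 := by
  have : HasFDerivAt (fun y : EuclideanSpace ℝ (Fin n) => y i - a i)
      (EuclideanSpace.proj (𝕜 := ℝ) i : EuclideanSpace ℝ (Fin n) →L[ℝ] ℝ) x :=
    (EuclideanSpace.proj (𝕜 := ℝ) i : EuclideanSpace ℝ (Fin n) →L[ℝ] ℝ).hasFDerivAt.sub_const _
  rw [pd, this.fderiv]
  simp

theorem pd_radial {φ : ℝ → ℝ} (hφ : ContDiff ℝ ∞ φ) (t : ℝ) (a x : EuclideanSpace ℝ (Fin n))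
    (j : Fin n) :
    pd (fun y => φ (t * ‖y - a‖ ^ 2)) j x =
      2 * t * ((x j - a j) * deriv φ (t * ‖x - a‖ ^ 2)) := by
  have h1 : HasFDerivAt (fun y : EuclideanSpace ℝ (Fin n) => t * ‖y - a‖ ^ 2)
      (t • (2 • innerSL ℝ (x - a))) x := by
    have h := ((hasFDerivAt_id x).sub_const a).norm_sq.const_mul t
    simpa using h
  rw [pd_comp (f := fun y => t * ‖y - a‖ ^ 2) (hφ.differentiable (by simp) _)
    h1.differentiableAt, pd, h1.fderiv]
  simp [EuclideanSpace.inner_single_right]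
  ring

theorem lap_coord_sub (a x : EuclideanSpace ℝ (Fin n)) (i : Fin n) :
    lap (fun y : EuclideanSpace ℝ (Fin n) => y i - a i) x = 0 := by
  have (j : Fin n) : pd (fun y : EuclideanSpace ℝ (Fin n) => y i - a i) j =
      fun _ => if i = j then 1 else 0 := funext fun y => pd_coord_sub a y i j
  simp [lap, this]

theorem lap_radial {φ : ℝ → ℝ} (hφ : ContDiff ℝ ∞ φ) (t : ℝ) (a x : EuclideanSpace ℝ (Fin n)) :
    lap (fun y => φ (t * ‖y - a‖ ^ 2)) x = 2 * t * (n * deriv φ (t * ‖x - a‖ ^ 2)) +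
      4 * t ^ 2 * ‖x - a‖ ^ 2 * deriv (deriv φ) (t * ‖x - a‖ ^ 2) := by
  have hφ' : ContDiff ℝ ∞ (deriv φ) := (contDiff_infty_iff_deriv.1 hφ).2
  have key (j : Fin n) : pd (pd (fun y => φ (t * ‖y - a‖ ^ 2)) j) j x =
      2 * t * deriv φ (t * ‖x - a‖ ^ 2) +
        4 * t ^ 2 * deriv (deriv φ) (t * ‖x - a‖ ^ 2) * (x j - a j) ^ 2 := by
    have h1 : pd (fun y => φ (t * ‖y - a‖ ^ 2)) j =
        fun y => (2 * t) * ((y j - a j) * deriv φ (t * ‖y - a‖ ^ 2)) :=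
      funext fun y => pd_radial hφ t a y j
    rw [h1, pd_mul (differentiableAt_const _)
      ((contDiff_coord_sub a j).mul (contDiff_radial hφ' t a)).contDiffAt.differentiableAt_of_infty,
      pd_mul (contDiff_coord_sub a j).contDiffAt.differentiableAt_of_infty
        (contDiff_radial hφ' t a).contDiffAt.differentiableAt_of_infty,
      pd_radial hφ', pd_coord_sub, pd_const]
    simp
    ring
  simp only [lap, key, Finset.sum_add_distrib, ← Finset.mul_sum]
  rw [EuclideanSpace.norm_sq_eq]
  simp
  ring

/-- There is a radial cutoff profile `P`, equal to `1` near the origin, such that every partial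
derivative of `x ↦ P (t‖x - a‖²)` is the Laplacian of a test function vanishing at `a` and
supported in the same ball. -/
theorem exists_radial_cutoff (hn : n ≠ 0) :
    ∃ (P : ℝ → ℝ) (C : ℝ), ContDiff ℝ ∞ P ∧ (∀ s, |s| ≤ 1 / 2 → P s = 1) ∧
      (∀ s, 1 ≤ s → P s = 0) ∧ (∀ s, 0 ≤ s → |P s| ≤ C) ∧ (∀ s, 0 ≤ s → |s * deriv P s| ≤ C) ∧
      ∀ (a : EuclideanSpace ℝ (Fin n)) (t : ℝ) (i : Fin n),
        ∃ θ : EuclideanSpace ℝ (Fin n) → ℝ, ContDiff ℝ ∞ θ ∧ θ a = 0 ∧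
          (∀ x, 1 ≤ t * ‖x - a‖ ^ 2 → θ x = 0) ∧
          ∀ x, lap θ x = pd (fun y => P (t * ‖y - a‖ ^ 2)) i x := by
  have hn' : (n : ℝ) ≠ 0 := by exact_mod_cast hn
  let b : ContDiffBump (0 : ℝ) := ⟨2 / 3, 1, by norm_num, by norm_num⟩
  set Q : ℝ → ℝ := fun s => (n : ℝ)⁻¹ * b s with hQ
  have hQs : ContDiff ℝ ∞ Q := contDiff_const.mul b.contDiff
  have hQ's : ContDiff ℝ ∞ (deriv Q) := (contDiff_infty_iff_deriv.1 hQs).2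
  have hQ1 (s : ℝ) (hs : 1 ≤ s) : Q s = 0 := by
    have : b s = 0 := b.zero_of_le_dist (by
      rw [Real.dist_eq, sub_zero]; exact hs.trans (le_abs_self s))
    simp [hQ, this]
  have hQ'1 (s : ℝ) (hs : 1 ≤ s) : deriv Q s = 0 := by
    have : IsMinOn (fun x => n * Q x) Set.univ s := fun x _ => by
      change n * Q s ≤ n * Q x
      rw [hQ1 s hs, mul_zero, hQ, mul_inv_cancel_left₀ hn']
      exact b.nonneg
    have h := (this.isLocalMin univ_mem).deriv_eq_zero
    rw [deriv_const_mul_field] at h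
    simpa [hn'] using h
  set P : ℝ → ℝ := fun s => n * Q s + 2 * (s * deriv Q s) with hP
  have hPs : ContDiff ℝ ∞ P :=
    (contDiff_const.mul hQs).add (contDiff_const.mul (contDiff_id.mul hQ's))
  have hP's : ContDiff ℝ ∞ (deriv P) := (contDiff_infty_iff_deriv.1 hPs).2
  have hP1 (s : ℝ) (hs : 1 ≤ s) : P s = 0 := by simp [hP, hQ1 s hs, hQ'1 s hs]
  have hP'1 (s : ℝ) (hs : 1 < s) : deriv P s = 0 := by
    have : P =ᶠ[𝓝 s] fun _ => 0 := by
      filter_upwards [lt_mem_nhds hs] with y hy using hP1 y hy.le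
    rw [this.deriv_eq, deriv_const]
  obtain ⟨C₁, hC₁⟩ := (isCompact_Icc (a := (0 : ℝ)) (b := 1)).exists_bound_of_continuousOn
    hPs.continuous.continuousOn
  obtain ⟨C₂, hC₂⟩ := (isCompact_Icc (a := (0 : ℝ)) (b := 1)).exists_bound_of_continuousOn
    (continuous_id.mul hP's.continuous).continuousOn
  have h0 : (0 : ℝ) ∈ Set.Icc (0 : ℝ) 1 := by simp
  refine ⟨P, max C₁ C₂, hPs, fun s hs => ?_, hP1, fun s hs => ?_, fun s hs => ?_,
    fun a t i => ⟨fun x => (x i - a i) * Q (t * ‖x - a‖ ^ 2),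
      (contDiff_coord_sub a i).mul (contDiff_radial hQs t a), by simp,
      fun x hx => by simp [hQ1 _ hx], fun x => ?_⟩⟩
  · have h1 : ∀ᶠ y in 𝓝 s, Q y = (n : ℝ)⁻¹ := by
      filter_upwards [Metric.ball_mem_nhds s (show (0 : ℝ) < 1 / 6 by norm_num)] with y hy
      have : b y = 1 := b.one_of_mem_closedBall (by
        rw [Metric.mem_ball, Real.dist_eq] at hy
        rw [Metric.mem_closedBall, Real.dist_eq, sub_zero]
        change |y| ≤ 2 / 3
        have := abs_sub_abs_le_abs_sub y s
        linarith)
      simp [hQ, this]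
    have h2 : deriv Q s = 0 := by
      rw [EventuallyEq.deriv_eq (f := fun _ => (n : ℝ)⁻¹) h1, deriv_const]
    simp [hP, h1.self_of_nhds, h2, hn']
  · rcases le_total s 1 with h | h
    · exact (hC₁ s ⟨hs, h⟩).trans (le_max_left _ _)
    · rw [hP1 s h, abs_zero]
      exact ((norm_nonneg _).trans (hC₁ 0 h0)).trans (le_max_left _ _)
  · rcases le_or_gt s 1 with h | h
    · exact (hC₂ s ⟨hs, h⟩).trans (le_max_right _ _)
    · rw [hP'1 s h, mul_zero, abs_zero]
      exact ((norm_nonneg _).trans (hC₂ 0 h0)).trans (le_max_right _ _)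
  · have hP' (s : ℝ) : deriv P s = (n + 2) * deriv Q s + 2 * (s * deriv (deriv Q) s) := by
      have hd : HasDerivAt Q (deriv Q s) s := (hQs.differentiable (by simp) s).hasDerivAt
      have hd' : HasDerivAt (deriv Q) (deriv (deriv Q) s) s :=
        (hQ's.differentiable (by simp) s).hasDerivAt
      have := ((hd.const_mul (n : ℝ)).add (((hasDerivAt_id s).mul hd').const_mul 2)).deriv
      change deriv P s = _ at this
      rw [this]
      simp
      ring
    rw [lap_mul (contDiff_coord_sub a i).contDiffAt (contDiff_radial hQs t a).contDiffAt,
      lap_coord_sub, lap_radial hQs, pd_radial hPs, hP']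
    simp only [gradInner, pd_coord_sub, ite_mul, one_mul, zero_mul, Finset.sum_ite_eq,
      Finset.mem_univ, if_true, pd_radial hQs]
    ring

end RadialCutoff

section Pole

variable {n : ℕ} {Ω : Set (EuclideanSpace ℝ (Fin n))} {u v w χ : EuclideanSpace ℝ (Fin n) → ℝ}
  {a b c x : EuclideanSpace ℝ (Fin n)}

/-- `u` is a locally integrable solution of `-Δu = δ_c` on `Ω`, smooth away from `c`. -/
structure IsFundamentalSolution (Ω : Set (EuclideanSpace ℝ (Fin n)))
    (u : EuclideanSpace ℝ (Fin n) → ℝ) (c : EuclideanSpace ℝ (Fin n)) : Prop where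
  smooth : ∀ x ∈ Ω, x ≠ c → ContDiffAt ℝ ∞ u x
  locInt : LocallyIntegrableOn u Ω volume
  distrib : ∀ φ : EuclideanSpace ℝ (Fin n) → ℝ, ContDiff ℝ ∞ φ → HasCompactSupport φ →
    tsupport φ ⊆ Ω → ∫ x in Ω, u x * lap φ x = -φ c

theorem setIntegral_eq_integral_of_tsupport {g : EuclideanSpace ℝ (Fin n) → ℝ}
    (hw : tsupport w ⊆ Ω) (hg : ∀ x, x ∉ tsupport w → g x = 0) :
    ∫ x in Ω, g x = ∫ x, g x :=
  setIntegral_eq_integral_of_forall_compl_eq_zero fun x hx => hg x fun h => hx (hw h)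

theorem tsupport_gradInner_subset (u v : EuclideanSpace ℝ (Fin n) → ℝ) :
    tsupport (gradInner u v) ⊆ tsupport u :=
  closure_minimal (fun x hx => by
    by_contra h
    exact hx (gradInner_eq_zero_of_notMem_tsupport h v)) isClosed_closure

theorem contDiff_gradInner_of_tsupport (hw : ContDiff ℝ ∞ w)
    (hv : ∀ x ∈ tsupport w, ContDiffAt ℝ ∞ v x) : ContDiff ℝ ∞ (gradInner w v) :=
  ContDiff.sum fun i _ => contDiff_mul_of_tsupport (hw.pd i) fun x hx =>
    (hv x (tsupport_pd_subset w i hx)).pd i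

namespace IsFundamentalSolution

theorem integrableOn_mul (hu : IsFundamentalSolution Ω u c) {g : EuclideanSpace ℝ (Fin n) → ℝ}
    (hg : Continuous g) (hgc : HasCompactSupport g) (hgΩ : tsupport g ⊆ Ω) :
    IntegrableOn (fun x => u x * g x) Ω := by
  have h1 : IntegrableOn (fun x => u x * g x) (tsupport g) :=
    (hu.locInt.integrableOn_compact_subset hgΩ hgc).mul_continuousOn hg.continuousOn hgc
  refine IntegrableOn.mono_set (t := Set.univ) ?_ (Set.subset_univ _)
  rw [integrableOn_univ]
  refine (integrableOn_iff_integrable_of_support_subset fun x hx => ?_).1 h1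
  exact subset_tsupport _ (right_ne_zero_of_mul hx)

theorem setIntegral_gradInner_eq_zero (hu : IsFundamentalSolution Ω u c) (hw : ContDiff ℝ ∞ w)
    (hwc : HasCompactSupport w) (hwΩ : tsupport w ⊆ Ω) (hc : c ∉ tsupport w) :
    ∫ x in Ω, gradInner w u x = 0 := by
  have hs : ∀ x ∈ tsupport w, ContDiffAt ℝ ∞ u x := fun x hx =>
    hu.smooth x (hwΩ hx) (fun h => hc (h ▸ hx))
  have h1 := hu.distrib w hw hwc hwΩ
  rw [image_eq_zero_of_notMem_tsupport hc, setIntegral_eq_integral_of_tsupport hwΩ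
    fun x hx => by rw [lap_eq_zero_of_notMem_tsupport hx, mul_zero]] at h1
  have h2 := integral_mul_lap_left hw
    (fun i => hwc.mono' (tsupport_pd_subset w i |>.trans' subset_closure))
    (fun i x hx => hs x (tsupport_pd_subset w i hx))
  rw [setIntegral_eq_integral_of_tsupport hwΩ
    fun x hx => gradInner_eq_zero_of_notMem_tsupport hx u]
  simp only [mul_comm (u _)] at h1
  linarith

theorem ae_lap_eq_zero (hu : IsFundamentalSolution Ω u c) (hΩ : IsOpen Ω) :
    ∀ᵐ x, x ∈ Ω \ {c} → lap u x = 0 := by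
  refine (hΩ.sdiff isClosed_singleton).ae_eq_zero_of_integral_contDiff_smul_eq_zero ?_ ?_
  · refine ContinuousOn.locallyIntegrableOn (fun x hx => ?_)
      (hΩ.sdiff isClosed_singleton).measurableSet
    exact (hu.smooth x hx.1 hx.2).lap.continuousAt.continuousWithinAt
  · intro w hw hwc hwΩ
    have hs : ∀ x ∈ tsupport w, ContDiffAt ℝ ∞ u x := fun x hx =>
      hu.smooth x (hwΩ hx).1 (hwΩ hx).2
    have hwΩ' := hwΩ.trans Set.sdiff_subset
    have h1 := hu.setIntegral_gradInner_eq_zero hw hwc hwΩ' fun h => (hwΩ h).2 rfl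
    rw [setIntegral_eq_integral_of_tsupport hwΩ'
      fun x hx => gradInner_eq_zero_of_notMem_tsupport hx u] at h1
    simp only [smul_eq_mul]
    rw [integral_mul_lap_right hw hwc hs, h1, neg_zero]

end IsFundamentalSolution

theorem tsupport_subset_closedBall {ρ : ℝ} (h : ∀ x, ρ ≤ ‖x - a‖ → w x = 0) :
    tsupport w ⊆ Metric.closedBall a ρ :=
  closure_minimal (fun x hx => by
    by_contra hx'
    rw [Metric.mem_closedBall, dist_eq_norm, not_le] at hx'
    exact hx (h x hx'.le)) Metric.isClosed_closedBall

theorem exists_lipschitz_pd (hv : ContDiffAt ℝ ∞ v a) :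
    ∃ L : ℝ, 0 ≤ L ∧ ∀ᶠ x in 𝓝 a, ∀ i, |pd v i x - pd v i a| ≤ L * ‖x - a‖ := by
  have h (i : Fin n) : ∃ K : NNReal, ∃ t ∈ 𝓝 a, LipschitzOnWith K (pd v i) t :=
    ((hv.pd i).of_le (by simp)).exists_lipschitzOnWith
  choose K t ht hK using h
  refine ⟨∑ i, (K i : ℝ), by positivity, eventually_all.2 fun i => ?_⟩
  filter_upwards [ht i] with x hx
  have h1 := (hK i).dist_le_mul x hx a (mem_of_mem_nhds (ht i))
  rw [Real.dist_eq, dist_eq_norm] at h1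
  refine h1.trans (mul_le_mul_of_nonneg_right ?_ (norm_nonneg _))
  exact Finset.single_le_sum (f := fun i => (K i : ℝ)) (fun _ _ => NNReal.coe_nonneg _)
    (Finset.mem_univ i)

theorem tendsto_setIntegral_mul_gradInner_radial (hΩ : IsOpen Ω)
    (hu : IsFundamentalSolution Ω u a) (ha : a ∈ Ω) {P : ℝ → ℝ} {C : ℝ} (hP : ContDiff ℝ ∞ P)
    (hP0 : ∀ s, 1 ≤ s → P s = 0) (hP' : ∀ s, 0 ≤ s → |s * deriv P s| ≤ C)
    (hθ : ∀ (t : ℝ) (i : Fin n),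
        ∃ θ : EuclideanSpace ℝ (Fin n) → ℝ, ContDiff ℝ ∞ θ ∧ θ a = 0 ∧
          (∀ x, 1 ≤ t * ‖x - a‖ ^ 2 → θ x = 0) ∧
          ∀ x, lap θ x = pd (fun y => P (t * ‖y - a‖ ^ 2)) i x)
    (hv : ContDiffAt ℝ ∞ v a) (hvs : ∀ᶠ x in 𝓝 a, ContDiffAt ℝ ∞ v x) :
    Tendsto (fun t : ℝ => ∫ x in Ω, u x * gradInner (fun y => P (t * ‖y - a‖ ^ 2)) v x)
      atTop (𝓝 0) := by
  obtain ⟨L, hL0, hL⟩ := exists_lipschitz_pd hv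
  obtain ⟨ρ, hρ0, hρ⟩ := Metric.nhds_basis_closedBall.eventually_iff.1
    (hL.and ((eventually_mem_set.2 (hΩ.mem_nhds ha)).and hvs))
  have hρΩ : Metric.closedBall a ρ ⊆ Ω := fun x hx => (hρ hx).2.1
  have hC : 0 ≤ C := (abs_nonneg _).trans (hP' 0 le_rfl)
  have hsupp {t : ℝ} (ht : (ρ ^ 2)⁻¹ ≤ t) (x : EuclideanSpace ℝ (Fin n)) (hx : ρ ≤ ‖x - a‖) :
      1 ≤ t * ‖x - a‖ ^ 2 := by
    calc (1 : ℝ) = (ρ ^ 2)⁻¹ * ρ ^ 2 := by field_simp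
      _ ≤ t * ‖x - a‖ ^ 2 :=
        mul_le_mul ht (pow_le_pow_left₀ hρ0.le hx 2) (by positivity) (ht.trans' (by positivity))
  have hPs (t : ℝ) := contDiff_radial hP t a
  have hPsupp {t : ℝ} (ht : (ρ ^ 2)⁻¹ ≤ t) :
      tsupport (fun y => P (t * ‖y - a‖ ^ 2)) ⊆ Metric.closedBall a ρ :=
    tsupport_subset_closedBall fun x hx => hP0 _ (hsupp ht x hx)
  have hcpt {g : EuclideanSpace ℝ (Fin n) → ℝ} (hg : tsupport g ⊆ Metric.closedBall a ρ) :
      HasCompactSupport g := (isCompact_closedBall a ρ).of_isClosed_subset isClosed_closure hg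
  have hi {t : ℝ} (ht : (ρ ^ 2)⁻¹ ≤ t) (i : Fin n) : IntegrableOn
      (fun x => pd v i a * (u x * pd (fun y => P (t * ‖y - a‖ ^ 2)) i x)) Ω := by
    have hs := (tsupport_pd_subset (fun y => P (t * ‖y - a‖ ^ 2)) i).trans (hPsupp ht)
    exact (hu.integrableOn_mul ((hPs t).pd i).continuous (hcpt hs) (hs.trans hρΩ)).const_mul _
  have hzero {t : ℝ} (ht : (ρ ^ 2)⁻¹ ≤ t) :
      ∫ x in Ω, u x * ∑ i, pd v i a * pd (fun y => P (t * ‖y - a‖ ^ 2)) i x = 0 := by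
    have h0 (i : Fin n) : ∫ x in Ω, u x * pd (fun y => P (t * ‖y - a‖ ^ 2)) i x = 0 := by
      obtain ⟨θ, hθs, hθa, hθ0, hθl⟩ := hθ t i
      have hs : tsupport θ ⊆ Metric.closedBall a ρ :=
        tsupport_subset_closedBall fun x hx => hθ0 x (hsupp ht x hx)
      simpa [hθl, hθa] using hu.distrib θ hθs (hcpt hs) (hs.trans hρΩ)
    simp only [Finset.mul_sum, mul_left_comm (u _)]
    rw [integral_finsetSum _ fun i _ => hi ht i]
    simp [integral_const_mul, h0]
  have hint {t : ℝ} (ht : (ρ ^ 2)⁻¹ ≤ t) :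
      IntegrableOn (fun x => u x * gradInner (fun y => P (t * ‖y - a‖ ^ 2)) v x) Ω := by
    have hs := (tsupport_gradInner_subset (fun y => P (t * ‖y - a‖ ^ 2)) v).trans (hPsupp ht)
    exact hu.integrableOn_mul (contDiff_gradInner_of_tsupport (hPs t)
      fun x hx => (hρ (hPsupp ht hx)).2.2).continuous (hcpt hs) (hs.trans hρΩ)
  have hint' {t : ℝ} (ht : (ρ ^ 2)⁻¹ ≤ t) : IntegrableOn
      (fun x => u x * ∑ i, pd v i a * pd (fun y => P (t * ‖y - a‖ ^ 2)) i x) Ω := by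
    simp only [Finset.mul_sum, mul_left_comm (u _)]
    exact integrable_finsetSum _ fun i _ => hi ht i
  have hP'0 (s : ℝ) (hs : 1 < s) : deriv P s = 0 := by
    have : P =ᶠ[𝓝 s] fun _ => 0 := by
      filter_upwards [lt_mem_nhds hs] with y hy using hP0 y hy.le
    rw [this.deriv_eq, deriv_const]
  have heq {t : ℝ} (x : EuclideanSpace ℝ (Fin n)) :
      gradInner (fun y => P (t * ‖y - a‖ ^ 2)) v x -
        ∑ i, pd v i a * pd (fun y => P (t * ‖y - a‖ ^ 2)) i x =
      ∑ i, (2 * t * (x i - a i) * deriv P (t * ‖x - a‖ ^ 2)) * (pd v i x - pd v i a) := by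
    rw [gradInner, ← Finset.sum_sub_distrib]
    refine Finset.sum_congr rfl fun i _ => ?_
    rw [pd_radial hP]
    ring
  have hbound {t : ℝ} (ht : (ρ ^ 2)⁻¹ ≤ t) (x : EuclideanSpace ℝ (Fin n)) :
      |∑ i, (2 * t * (x i - a i) * deriv P (t * ‖x - a‖ ^ 2)) * (pd v i x - pd v i a)| ≤
        (Metric.closedBall a ρ).indicator (fun _ => n * (2 * L * C)) x := by
    have ht0 : 0 < t := ht.trans_lt' (by positivity)
    by_cases hx : x ∈ Metric.closedBall a ρ
    · rw [Set.indicator_of_mem hx]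
      refine (Finset.abs_sum_le_sum_abs _ _).trans ((Finset.sum_le_card_nsmul _ _ (2 * L * C)
        fun i _ => ?_).trans_eq (by simp))
      have h1 : |x i - a i| ≤ ‖x - a‖ := by simpa using PiLp.norm_apply_le (x - a) i
      have h2 := (hρ hx).1 i
      have h3 := hP' (t * ‖x - a‖ ^ 2) (by positivity)
      rw [abs_mul, abs_of_nonneg (by positivity : 0 ≤ t * ‖x - a‖ ^ 2)] at h3
      simp only [abs_mul, abs_two, abs_of_pos ht0]
      calc 2 * t * |x i - a i| * |deriv P (t * ‖x - a‖ ^ 2)| * |pd v i x - pd v i a|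
          ≤ 2 * t * ‖x - a‖ * |deriv P (t * ‖x - a‖ ^ 2)| * (L * ‖x - a‖) := by gcongr
        _ = 2 * L * (t * ‖x - a‖ ^ 2 * |deriv P (t * ‖x - a‖ ^ 2)|) := by ring
        _ ≤ 2 * L * C := by gcongr
    · rw [Set.indicator_of_notMem hx]
      rw [Metric.mem_closedBall, dist_eq_norm, not_le] at hx
      have h1 : 1 < t * ‖x - a‖ ^ 2 := by
        calc (1 : ℝ) = (ρ ^ 2)⁻¹ * ρ ^ 2 := by field_simp
          _ < t * ‖x - a‖ ^ 2 :=
            mul_lt_mul' ht (pow_lt_pow_left₀ hx hρ0.le two_ne_zero) (by positivity) ht0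
      simp [hP'0 _ h1]
  have hev : ∀ᶠ t : ℝ in atTop, (ρ ^ 2)⁻¹ ≤ t := eventually_ge_atTop _
  have hlim : Tendsto (fun t : ℝ => ∫ x in Ω, u x * (gradInner (fun y => P (t * ‖y - a‖ ^ 2)) v x -
      ∑ i, pd v i a * pd (fun y => P (t * ‖y - a‖ ^ 2)) i x)) atTop (𝓝 (∫ x in Ω, (0 : ℝ))) := by
    refine tendsto_integral_filter_of_dominated_convergence
      (fun x => (Metric.closedBall a ρ).indicator (fun x => |u x| * (n * (2 * L * C))) x)
      ?_ ?_ ?_ ?_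
    · filter_upwards [hev] with t ht
      simp only [mul_sub]
      exact ((hint ht).sub (hint' ht)).aestronglyMeasurable
    · filter_upwards [hev] with t ht
      refine Eventually.of_forall fun x => ?_
      rw [heq, Real.norm_eq_abs, abs_mul, Set.indicator_mul_right _ (fun x => |u x|)]
      exact mul_le_mul_of_nonneg_left (hbound ht x) (abs_nonneg _)
    · have h1 := ((hu.locInt.integrableOn_compact_subset hρΩ
        (isCompact_closedBall a ρ)).abs.mul_const
        (n * (2 * L * C)))
      exact (IntegrableOn.integrable_indicator h1 Metric.isClosed_closedBall.measurableSet).restrict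
    · refine Eventually.of_forall fun x => ?_
      simp only [heq]
      refine tendsto_const_nhds.congr' ?_
      by_cases hx : x = a
      · simp [hx]
      · have hx' : 0 < ‖x - a‖ ^ 2 := by
          have := norm_pos_iff.2 (sub_ne_zero.2 hx)
          positivity
        filter_upwards [eventually_gt_atTop (‖x - a‖ ^ 2)⁻¹] with t ht
        have h1 : 1 < t * ‖x - a‖ ^ 2 := by
          rwa [inv_lt_iff_one_lt_mul₀ hx'] at ht
        simp [hP'0 _ h1]
  rw [integral_zero] at hlim
  refine hlim.congr' ?_
  filter_upwards [hev] with t ht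
  simp only [mul_sub]
  rw [integral_sub (hint ht) (hint' ht), hzero ht, sub_zero]

end Pole

section Energy

variable {n : ℕ} {Ω : Set (EuclideanSpace ℝ (Fin n))} {u v w χ : EuclideanSpace ℝ (Fin n) → ℝ}
  {a b x : EuclideanSpace ℝ (Fin n)}

theorem gradInner_sub_left (hu : ContDiff ℝ ∞ u) (hw : ContDiff ℝ ∞ w)
    (v : EuclideanSpace ℝ (Fin n) → ℝ) (x : EuclideanSpace ℝ (Fin n)) :
    gradInner (fun y => u y - w y) v x = gradInner u v x - gradInner w v x := by
  rw [gradInner, gradInner, gradInner, ← Finset.sum_sub_distrib]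
  refine Finset.sum_congr rfl fun i _ => ?_
  rw [pd_sub (hu.contDiffAt.differentiableAt_of_infty) (hw.contDiffAt.differentiableAt_of_infty),
    sub_mul]

/-- Integration by parts against a cutoff equal to `1` near the pole of `u`: the pole produces
no additional term. -/
theorem setIntegral_mul_gradInner_of_eventuallyEq_one (hn : n ≠ 0) (hΩ : IsOpen Ω)
    (hu : IsFundamentalSolution Ω u a) (hv : IsFundamentalSolution Ω v b) (ha : a ∈ Ω)
    (hab : a ≠ b) (hint : IntegrableOn (gradInner u v) Ω) (hχ : ContDiff ℝ ∞ χ)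
    (hχc : HasCompactSupport χ) (hχΩ : tsupport χ ⊆ Ω \ {b}) (hχa : ∀ᶠ x in 𝓝 a, χ x = 1) :
    ∫ x in Ω, χ x * gradInner u v x = -∫ x in Ω, u x * gradInner χ v x := by
  have : Nonempty (Fin n) := ⟨⟨0, Nat.pos_of_ne_zero hn⟩⟩
  obtain ⟨P, C, hP, hP1, hP0, hPC, hP', hθ⟩ := exists_radial_cutoff hn
  have hΩ' : IsOpen (Ω \ {b}) := hΩ.sdiff isClosed_singleton
  have hvs : ∀ x ∈ Ω \ {b}, ContDiffAt ℝ ∞ v x := fun x hx => hv.smooth x hx.1 hx.2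
  obtain ⟨ρ, hρ0, hρ⟩ := Metric.nhds_basis_closedBall.eventually_iff.1
    (hχa.and (hΩ'.mem_nhds ⟨ha, hab⟩))
  set φ : ℝ → EuclideanSpace ℝ (Fin n) → ℝ := fun t x => P (t * ‖x - a‖ ^ 2) with hφ
  have hφs (t : ℝ) : ContDiff ℝ ∞ (φ t) := contDiff_radial hP t a
  have hev : ∀ᶠ t : ℝ in atTop, 0 ≤ t ∧ tsupport (φ t) ⊆ Metric.closedBall a ρ := by
    filter_upwards [eventually_ge_atTop (ρ ^ 2)⁻¹] with t ht
    refine ⟨ht.trans' (by positivity), tsupport_subset_closedBall fun x hx => hP0 _ ?_⟩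
    calc (1 : ℝ) = (ρ ^ 2)⁻¹ * ρ ^ 2 := by field_simp
      _ ≤ t * ‖x - a‖ ^ 2 :=
        mul_le_mul ht (pow_le_pow_left₀ hρ0.le hx 2) (by positivity) (ht.trans' (by positivity))
  have hone (t : ℝ) : ∀ᶠ x in 𝓝 a, φ t x = 1 := by
    have : Tendsto (fun x => |t * ‖x - a‖ ^ 2|) (𝓝 a) (𝓝 0) := by
      have : Continuous fun x : EuclideanSpace ℝ (Fin n) => |t * ‖x - a‖ ^ 2| := by fun_prop
      simpa using this.tendsto a
    filter_upwards [this.eventually_le_const one_half_pos] with x hx using hP1 _ hx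
  have hae : ∀ᵐ x ∂volume.restrict Ω, x ∈ Ω ∧ x ≠ a :=
    (ae_restrict_mem hΩ.measurableSet).and (ae_restrict_of_ae (Measure.ae_ne volume a))
  have hi2 : IntegrableOn (fun x => u x * gradInner χ v x) Ω := by
    have hs := tsupport_gradInner_subset χ v
    exact hu.integrableOn_mul (contDiff_gradInner_of_tsupport hχ
      fun x hx => hvs x (hχΩ hx)).continuous (hχc.of_isClosed_subset isClosed_closure hs)
      (hs.trans (hχΩ.trans Set.sdiff_subset))
  obtain ⟨M, hM⟩ := hχc.exists_bound_of_continuous hχ.continuous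
  have hbd {t : ℝ} (ht : 0 ≤ t) (x : EuclideanSpace ℝ (Fin n)) : ‖χ x - φ t x‖ ≤ M + C :=
    (norm_sub_le _ _).trans (add_le_add (hM x) (hPC _ (by positivity)))
  have hi1 {t : ℝ} (ht : 0 ≤ t) :
      IntegrableOn (fun x => (χ x - φ t x) * gradInner u v x) Ω :=
    hint.bdd_mul (hχ.continuous.sub (hφs t).continuous).aestronglyMeasurable
      (Eventually.of_forall (hbd ht))
  have key : ∀ᶠ t : ℝ in atTop, ∫ x in Ω, (χ x - φ t x) * gradInner u v x =
      -(∫ x in Ω, u x * gradInner χ v x) + ∫ x in Ω, u x * gradInner (φ t) v x := by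
    filter_upwards [hev] with t ⟨ht0, ht⟩
    have hW : ContDiff ℝ ∞ fun x => χ x - φ t x := hχ.sub (hφs t)
    have hWs : tsupport (fun x => χ x - φ t x) ⊆ tsupport χ ∪ tsupport (φ t) :=
      closure_minimal (fun x hx => by
        by_contra h
        rw [Set.mem_union, not_or] at h
        exact hx (by simp [image_eq_zero_of_notMem_tsupport h.1,
          image_eq_zero_of_notMem_tsupport h.2]))
        (isClosed_closure.union isClosed_closure)
    have hWc : HasCompactSupport fun x => χ x - φ t x :=
      (hχc.isCompact.union (isCompact_closedBall a ρ)).of_isClosed_subset isClosed_closure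
        (hWs.trans (Set.union_subset_union_right _ ht))
    have hWΩ : tsupport (fun x => χ x - φ t x) ⊆ Ω \ {b} :=
      hWs.trans (Set.union_subset hχΩ (ht.trans fun x hx => (hρ hx).2))
    have hWa : a ∉ tsupport fun x => χ x - φ t x := by
      rw [notMem_tsupport_iff_eventuallyEq]
      filter_upwards [hχa, hone t] with x h1 h2
      simp [h1, h2]
    have hsub : tsupport (fun x => (χ x - φ t x) * u x) ⊆ tsupport fun x => χ x - φ t x :=
      tsupport_mul_subset_left
    have hi3 : IntegrableOn (fun x => u x * gradInner (φ t) v x) Ω := by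
      have hs := (tsupport_gradInner_subset (φ t) v).trans ht
      exact hu.integrableOn_mul (contDiff_gradInner_of_tsupport (hφs t)
        fun x hx => hvs x (hρ (ht hx)).2).continuous
        ((isCompact_closedBall a ρ).of_isClosed_subset isClosed_closure hs)
        (hs.trans fun x hx => (hρ hx).2.1)
    have h0 := hv.setIntegral_gradInner_eq_zero
      (contDiff_mul_of_tsupport hW fun x hx => hu.smooth x (hWΩ hx).1 fun h => hWa (h ▸ hx))
      hWc.mul_right (hsub.trans (hWΩ.trans Set.sdiff_subset)) fun h => (hWΩ (hsub h)).2 rfl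
    have h1 : ∫ x in Ω, gradInner (fun x => (χ x - φ t x) * u x) v x =
        ∫ x in Ω, ((χ x - φ t x) * gradInner u v x + u x * gradInner χ v x -
          u x * gradInner (φ t) v x) := by
      refine integral_congr_ae ?_
      filter_upwards [hae] with x hx
      rw [gradInner_mul_left hW.contDiffAt (hu.smooth x hx.1 hx.2),
        gradInner_sub_left hχ (hφs t)]
      ring
    have h2 := integral_sub ((hi1 ht0).add hi2) hi3
    have h3 := integral_add (hi1 ht0) hi2
    simp only [Pi.add_apply] at h2
    linarith
  have hlim1 : Tendsto (fun t : ℝ => ∫ x in Ω, (χ x - φ t x) * gradInner u v x) atTop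
      (𝓝 (∫ x in Ω, χ x * gradInner u v x)) := by
    refine tendsto_integral_filter_of_dominated_convergence
      (fun x => (M + C) * ‖gradInner u v x‖) ?_ ?_ (hint.norm.const_mul _) ?_
    · filter_upwards [hev] with t ht using (hi1 ht.1).aestronglyMeasurable
    · filter_upwards [hev] with t ht
      refine Eventually.of_forall fun x => ?_
      rw [norm_mul]
      exact mul_le_mul_of_nonneg_right (hbd ht.1 x) (norm_nonneg _)
    · filter_upwards [hae] with x hx
      refine tendsto_const_nhds.congr' ?_
      have hx' : 0 < ‖x - a‖ ^ 2 := by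
        have := norm_pos_iff.2 (sub_ne_zero.2 hx.2)
        positivity
      filter_upwards [eventually_gt_atTop (‖x - a‖ ^ 2)⁻¹] with t ht
      rw [inv_lt_iff_one_lt_mul₀ hx'] at ht
      simp [hφ, hP0 _ ht.le]
  have hlim2 := tendsto_setIntegral_mul_gradInner_radial hΩ hu ha hP hP0 hP' (hθ a)
    (hvs a ⟨ha, hab⟩) (eventually_of_mem (hΩ'.mem_nhds ⟨ha, hab⟩) hvs)
  have hlim3 := (hlim2.const_add (-(∫ x in Ω, u x * gradInner χ v x))).congr'
    (key.mono fun t ht => ht.symm)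
  rw [add_zero] at hlim3
  exact tendsto_nhds_unique hlim1 hlim3

theorem exists_truncation : ∃ (β : ℝ → ℝ) (C : ℝ), ContDiff ℝ ∞ β ∧ (∀ s, |s| ≤ 1 → β s = 0) ∧
    (∀ s, 2 ≤ |s| → β s = s) ∧ (∀ s, |β s| ≤ |s|) ∧ (∀ s, 2 < |s| → deriv β s = 1) ∧
    ∀ s, |deriv β s| ≤ C := by
  let f : ContDiffBump (0 : ℝ) := ⟨1, 2, one_pos, one_lt_two⟩
  have hd (s : ℝ) : HasDerivAt (fun s => s * (1 - f s)) (1 * (1 - f s) + s * (0 - deriv f s)) s :=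
    (hasDerivAt_id s).mul ((hasDerivAt_const s (1 : ℝ)).sub
      ((f.contDiff (n := 1)).differentiable one_ne_zero s).hasDerivAt)
  have hout (s : ℝ) (hs : 2 ≤ |s|) : f s = 0 := f.zero_of_le_dist (by simpa using hs)
  obtain ⟨C, hC⟩ :=
    (f.hasCompactSupport.deriv.mul_left (f := fun s : ℝ => s)).exists_bound_of_continuous
      (continuous_id.mul ((f.contDiff (n := 1)).continuous_deriv le_rfl))
  refine ⟨fun s => s * (1 - f s), 1 + C, contDiff_id.mul (contDiff_const.sub f.contDiff),
    fun s hs => ?_, fun s hs => ?_, fun s => ?_, fun s hs => ?_, fun s => ?_⟩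
  · simp [f.one_of_mem_closedBall (show s ∈ Metric.closedBall 0 f.rIn by simpa using hs)]
  · simp [hout s hs]
  · rw [abs_mul]
    refine mul_le_of_le_one_right (abs_nonneg _) ?_
    rw [abs_le]
    constructor <;> linarith [f.nonneg (x := s), f.le_one (x := s)]
  · have h1 : deriv f s = 0 := by
      have : f =ᶠ[𝓝 s] fun _ => (0 : ℝ) := by
        filter_upwards [continuous_abs.continuousAt.eventually (lt_mem_nhds hs)] with y hy
          using hout y hy.le
      rw [this.deriv_eq, deriv_const]
    rw [(hd s).deriv, hout s hs.le, h1]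
    ring
  · rw [(hd s).deriv]
    have h1 := hC s
    simp only [Pi.mul_apply, Real.norm_eq_abs] at h1
    rw [abs_le] at h1 ⊢
    constructor <;> linarith [f.nonneg (x := s), f.le_one (x := s), h1.1, h1.2]

theorem notMem_tsupport_pd (hχ : ∀ᶠ y in 𝓝 x, χ y = 1) (i : Fin n) : x ∉ tsupport (pd χ i) := by
  rw [notMem_tsupport_iff_eventuallyEq]
  exact (pd_eventuallyEq hχ i).trans (Eventually.of_forall fun y => pd_const 1 i y)

namespace IsFundamentalSolution

theorem contDiffAt_of_mem_tsupport_pd (hu : IsFundamentalSolution Ω u a)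
    (hχΩ : tsupport χ ⊆ Ω) (hχa : ∀ᶠ x in 𝓝 a, χ x = 1) (i : Fin n) (hx : x ∈ tsupport (pd χ i)) :
    ContDiffAt ℝ ∞ u x :=
  hu.smooth x (hχΩ (tsupport_pd_subset χ i hx))
    fun h => notMem_tsupport_pd hχa i (h ▸ hx)

theorem contDiff_gradInner (hu : IsFundamentalSolution Ω u a) (hχ : ContDiff ℝ ∞ χ)
    (hχΩ : tsupport χ ⊆ Ω) (hχa : ∀ᶠ x in 𝓝 a, χ x = 1) : ContDiff ℝ ∞ (gradInner χ u) :=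
  ContDiff.sum fun i _ => contDiff_mul_of_tsupport (hχ.pd i) fun _ hx =>
    (hu.contDiffAt_of_mem_tsupport_pd hχΩ hχa i hx).pd i

theorem integrableOn_mul_gradInner (hv : IsFundamentalSolution Ω v b)
    (hu : IsFundamentalSolution Ω u a) (hχ : ContDiff ℝ ∞ χ) (hχc : HasCompactSupport χ)
    (hχΩ : tsupport χ ⊆ Ω) (hχa : ∀ᶠ x in 𝓝 a, χ x = 1) :
    IntegrableOn (fun x => v x * gradInner χ u x) Ω := by
  have hs := tsupport_gradInner_subset χ u
  exact hv.integrableOn_mul (hu.contDiff_gradInner hχ hχΩ hχa).continuous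
    (hχc.of_isClosed_subset isClosed_closure hs) (hs.trans hχΩ)

end IsFundamentalSolution

/-- Integration by parts near the boundary, where `v` vanishes; `1 - χ` is supported away from
both poles. -/
theorem setIntegral_one_sub_mul_gradInner (hn : n ≠ 0) (hΩ : IsOpen Ω)
    (hΩb : Bornology.IsBounded Ω)
    (hu : IsFundamentalSolution Ω u a) (hv : IsFundamentalSolution Ω v b)
    (hv0 : ∀ x ∉ Ω, Tendsto v (𝓝 x) (𝓝 0))
    (hint : IntegrableOn (gradInner v u) Ω) (hχ : ContDiff ℝ ∞ χ)
    (hχc : HasCompactSupport χ) (hχΩ : tsupport χ ⊆ Ω) (hχa : ∀ᶠ x in 𝓝 a, χ x = 1)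
    (hχb : ∀ᶠ x in 𝓝 b, χ x = 1) :
    ∫ x in Ω, (1 - χ x) * gradInner v u x = ∫ x in Ω, v x * gradInner χ u x := by
  have : Nonempty (Fin n) := ⟨⟨0, Nat.pos_of_ne_zero hn⟩⟩
  obtain ⟨β, C, hβ, hβ0, hβ1, hβle, hβ'1, hβ'⟩ := exists_truncation
  have hΩ' : IsOpen (Ω \ {b}) := hΩ.sdiff isClosed_singleton
  have hvs : ∀ x ∈ Ω \ {b}, ContDiffAt ℝ ∞ v x := fun x hx => hv.smooth x hx.1 hx.2
  have hvm : AEStronglyMeasurable v (volume.restrict Ω) := hv.locInt.aestronglyMeasurable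
  have hae : ∀ᵐ x ∂volume.restrict Ω, x ∈ Ω \ {b} :=
    (ae_restrict_mem hΩ.measurableSet).and (ae_restrict_of_ae (Measure.ae_ne volume b))
  have hzero : ∀ᵐ x ∂volume.restrict Ω, v x = 0 → gradInner v u x = 0 := by
    have hs : MeasurableSet ((Ω \ {b}) \ ((Ω \ {b}) ∩ v ⁻¹' {0}ᶜ)) :=
      hΩ'.measurableSet.diff (ContinuousOn.isOpen_inter_preimage
        (fun x hx => (hvs x hx).continuousAt.continuousWithinAt) hΩ'
        isOpen_compl_singleton).measurableSet
    have h1 : ∀ᵐ x, x ∈ (Ω \ {b}) \ ((Ω \ {b}) ∩ v ⁻¹' {0}ᶜ) → ∀ i, pd v i x = 0 := by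
      rw [← ae_restrict_iff' hs, ae_all_iff]
      refine ae_pd_eq_zero_of_eq_zero hs (fun x hx => (hvs x hx.1).differentiableAt_of_infty)
        fun x hx => ?_
      by_contra h
      exact hx.2 ⟨hx.1, h⟩
    filter_upwards [hae, ae_restrict_of_ae h1] with x hx h2 h0
    have := h2 ⟨hx, fun h => h.2 h0⟩
    simp [gradInner, this]
  obtain ⟨M, hM⟩ := hχc.exists_bound_of_continuous hχ.continuous
  have hχ1 (x : EuclideanSpace ℝ (Fin n)) : |1 - χ x| ≤ 1 + M := by
    have h := norm_sub_le 1 (χ x)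
    rw [norm_one] at h
    exact h.trans (by linarith [hM x])
  have hi := hv.integrableOn_mul_gradInner hu hχ hχc hχΩ hχa
  have hγ (t : ℝ) : ContDiff ℝ ∞ fun s => t⁻¹ * β (t * s) :=
    contDiff_const.mul (hβ.comp (contDiff_const.mul contDiff_id))
  have hγle {t : ℝ} (ht : 0 < t) (s : ℝ) : |t⁻¹ * β (t * s)| ≤ |s| := by
    rw [abs_mul, abs_of_pos (inv_pos.2 ht), inv_mul_le_iff₀ ht]
    simpa [abs_mul, abs_of_pos ht] using hβle (t * s)
  have hγ' {t : ℝ} (ht : 0 < t) (s : ℝ) : deriv (fun s => t⁻¹ * β (t * s)) s = deriv β (t * s) := by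
    have h1 : HasDerivAt (fun s => t⁻¹ * β (t * s)) (t⁻¹ * (deriv β (t * s) * (t * 1))) s :=
      (((hβ.differentiable (by simp)) (t * s)).hasDerivAt.comp s
        ((hasDerivAt_id s).const_mul t)).const_mul t⁻¹
    rw [h1.deriv]
    field_simp
  have hi1 {t : ℝ} (ht : 0 < t) :
      IntegrableOn (fun x => t⁻¹ * β (t * v x) * gradInner χ u x) Ω := by
    refine Integrable.mono hi (((hγ t).continuous.comp_aestronglyMeasurable hvm).mul
      (hu.contDiff_gradInner hχ hχΩ hχa).continuous.aestronglyMeasurable)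
      (Eventually.of_forall fun x => ?_)
    rw [norm_mul _ (gradInner χ u x), norm_mul _ (gradInner χ u x)]
    exact mul_le_mul_of_nonneg_right (hγle ht (v x)) (norm_nonneg (gradInner χ u x))
  have hbd (t : ℝ) (x : EuclideanSpace ℝ (Fin n)) :
      ‖(1 - χ x) * deriv β (t * v x)‖ ≤ (1 + M) * C := by
    rw [norm_mul]
    exact mul_le_mul (hχ1 x) (hβ' _) (norm_nonneg _) ((abs_nonneg (1 - χ x)).trans (hχ1 x))
  have hi2 (t : ℝ) :
      IntegrableOn (fun x => (1 - χ x) * deriv β (t * v x) * gradInner v u x) Ω :=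
    hint.bdd_mul ((continuous_const.sub hχ.continuous).aestronglyMeasurable.mul
      ((hβ.continuous_deriv (by simp)).comp_aestronglyMeasurable (hvm.const_mul t)))
      (Eventually.of_forall (hbd t))
  have key : ∀ᶠ t : ℝ in atTop, ∫ x in Ω, (1 - χ x) * deriv β (t * v x) * gradInner v u x =
      ∫ x in Ω, t⁻¹ * β (t * v x) * gradInner χ u x := by
    filter_upwards [eventually_gt_atTop 0] with t ht
    set w : EuclideanSpace ℝ (Fin n) → ℝ := fun x => (1 - χ x) * (t⁻¹ * β (t * v x)) with hw
    have hout (x : EuclideanSpace ℝ (Fin n)) (hx : x ∉ Ω) : w =ᶠ[𝓝 x] fun _ => 0 := by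
      have h1 : Tendsto (fun y => |t * v y|) (𝓝 x) (𝓝 0) := by
        simpa using ((hv0 x hx).const_mul t).abs
      filter_upwards [h1.eventually_le_const one_pos] with y hy
      simp [hw, hβ0 _ hy]
    have hpole (x : EuclideanSpace ℝ (Fin n)) (hx : ∀ᶠ y in 𝓝 x, χ y = 1) :
        w =ᶠ[𝓝 x] fun _ => 0 := by
      filter_upwards [hx] with y hy
      simp [hw, hy]
    have hvw (x : EuclideanSpace ℝ (Fin n)) (hx : x ∈ Ω \ {b}) :
        ContDiffAt ℝ ∞ (fun x => t⁻¹ * β (t * v x)) x :=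
      (hγ t).contDiffAt.comp x (hvs x hx)
    have hws : ContDiff ℝ ∞ w := by
      refine contDiff_iff_contDiffAt.2 fun x => ?_
      by_cases hx : x ∈ Ω
      · by_cases hxb : x = b
        · exact contDiffAt_const.congr_of_eventuallyEq (hpole x (hxb ▸ hχb))
        · exact (contDiff_const.sub hχ).contDiffAt.mul (hvw x ⟨hx, hxb⟩)
      · exact contDiffAt_const.congr_of_eventuallyEq (hout x hx)
    have hwΩ : tsupport w ⊆ Ω := fun x hx => by
      by_contra h
      exact notMem_tsupport_iff_eventuallyEq.2 (hout x h) hx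
    have h0 := hu.setIntegral_gradInner_eq_zero hws
      (Metric.isCompact_of_isClosed_isBounded isClosed_closure (hΩb.subset hwΩ)) hwΩ
      (notMem_tsupport_iff_eventuallyEq.2 (hpole a hχa))
    have h1 : ∫ x in Ω, gradInner w u x = ∫ x in Ω, ((1 - χ x) * deriv β (t * v x) * gradInner v u x
        - t⁻¹ * β (t * v x) * gradInner χ u x) := by
      refine integral_congr_ae ?_
      filter_upwards [hae] with x hx
      have h2 : gradInner (fun x => t⁻¹ * β (t * v x)) u x =
          deriv β (t * v x) * gradInner v u x := by
        rw [gradInner, gradInner, Finset.mul_sum]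
        refine Finset.sum_congr rfl fun i _ => ?_
        rw [pd_comp (φ := fun s => t⁻¹ * β (t * s)) ((hγ t).differentiable (by simp) _)
          (hvs x hx).differentiableAt_of_infty, hγ' ht, mul_assoc]
      have h3 : gradInner (fun x => 1 - χ x) u x = -gradInner χ u x := by
        rw [gradInner_sub_left contDiff_const hχ]
        simp [gradInner, pd_const]
      rw [hw, gradInner_mul_left (contDiff_const.sub hχ).contDiffAt (hvw x hx), h2, h3]
      ring
    rw [integral_sub (hi2 t) (hi1 ht)] at h1
    linarith
  have hlim1 : Tendsto (fun t : ℝ => ∫ x in Ω, (1 - χ x) * deriv β (t * v x) * gradInner v u x)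
      atTop (𝓝 (∫ x in Ω, (1 - χ x) * gradInner v u x)) := by
    refine tendsto_integral_filter_of_dominated_convergence
      (fun x => ((1 + M) * C) * ‖gradInner v u x‖) ?_ ?_ (hint.norm.const_mul _) ?_
    · exact Eventually.of_forall fun t => (hi2 t).aestronglyMeasurable
    · refine Eventually.of_forall fun t => Eventually.of_forall fun x => ?_
      rw [norm_mul]
      exact mul_le_mul_of_nonneg_right (hbd t x) (norm_nonneg _)
    · filter_upwards [hzero] with x hx
      refine tendsto_const_nhds.congr' ?_
      by_cases h0 : v x = 0
      · simp [hx h0]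
      · filter_upwards [eventually_gt_atTop (2 / |v x|), eventually_gt_atTop 0] with t ht ht0
        rw [div_lt_iff₀ (abs_pos.2 h0)] at ht
        rw [hβ'1 _ (by rwa [abs_mul, abs_of_pos ht0]), mul_one]
  have hlim2 : Tendsto (fun t : ℝ => ∫ x in Ω, t⁻¹ * β (t * v x) * gradInner χ u x)
      atTop (𝓝 (∫ x in Ω, v x * gradInner χ u x)) := by
    refine tendsto_integral_filter_of_dominated_convergence
      (fun x => ‖v x * gradInner χ u x‖) ?_ ?_ hi.norm ?_
    · filter_upwards [eventually_gt_atTop 0] with t ht using (hi1 ht).aestronglyMeasurable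
    · filter_upwards [eventually_gt_atTop 0] with t ht
      refine Eventually.of_forall fun x => ?_
      rw [norm_mul _ (gradInner χ u x), norm_mul _ (gradInner χ u x)]
      exact mul_le_mul_of_nonneg_right (hγle ht (v x)) (norm_nonneg (gradInner χ u x))
    · refine Eventually.of_forall fun x => tendsto_const_nhds.congr' ?_
      filter_upwards [eventually_gt_atTop (2 / |v x|), eventually_gt_atTop 0] with t ht ht0
      by_cases h0 : v x = 0
      · simp [h0, hβ0 0]
      · rw [div_lt_iff₀ (abs_pos.2 h0)] at ht
        rw [hβ1 _ (by rw [abs_mul, abs_of_pos ht0]; exact ht.le), inv_mul_cancel_left₀ ht0.ne']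
  exact tendsto_nhds_unique (hlim1.congr' key) hlim2

theorem exists_cutoff {U : Set (EuclideanSpace ℝ (Fin n))} (hU : IsOpen U) (ha : a ∈ U) :
    ∃ χ : EuclideanSpace ℝ (Fin n) → ℝ, ContDiff ℝ ∞ χ ∧ HasCompactSupport χ ∧ tsupport χ ⊆ U ∧
      ∀ᶠ x in 𝓝 a, χ x = 1 := by
  obtain ⟨r, hr, hrU⟩ := Metric.nhds_basis_closedBall.mem_iff.1 (hU.mem_nhds ha)
  let f : ContDiffBump a := ⟨r / 2, r, half_pos hr, half_lt_self hr⟩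
  exact ⟨f, f.contDiff, f.hasCompactSupport, f.tsupport_eq.trans_subset hrU,
    f.eventuallyEq_one⟩

theorem IsFundamentalSolution.eq_sub_setIntegral (hn : n ≠ 0) (hΩ : IsOpen Ω)
    (hu : IsFundamentalSolution Ω u a) (hv : IsFundamentalSolution Ω v b)
    (hχ : ContDiff ℝ ∞ χ) (hχc : HasCompactSupport χ) (hχΩ : tsupport χ ⊆ Ω \ {b})
    (hχa : ∀ᶠ x in 𝓝 a, χ x = 1) :
    v a = (∫ x in Ω, v x * gradInner χ u x) - ∫ x in Ω, u x * gradInner χ v x := by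
  have : Nonempty (Fin n) := ⟨⟨0, Nat.pos_of_ne_zero hn⟩⟩
  have hχΩ' := hχΩ.trans Set.sdiff_subset
  have hχb : b ∉ tsupport χ := fun h => (hχΩ h).2 rfl
  have hvs : ∀ x ∈ tsupport χ, ContDiffAt ℝ ∞ v x := fun x hx =>
    hv.smooth x (hχΩ hx).1 (hχΩ hx).2
  have hsub : tsupport (fun x => χ x * v x) ⊆ tsupport χ := tsupport_mul_subset_left
  have hi1 := hv.integrableOn_mul_gradInner hu hχ hχc hχΩ' hχa
  have hs2 := tsupport_gradInner_subset χ v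
  have hi2 : IntegrableOn (fun x => u x * gradInner χ v x) Ω :=
    hu.integrableOn_mul (contDiff_gradInner_of_tsupport hχ hvs).continuous
      (hχc.of_isClosed_subset isClosed_closure hs2) (hs2.trans hχΩ')
  have hlap : ContDiff ℝ ∞ (lap χ) := contDiff_iff_contDiffAt.2 fun x => hχ.contDiffAt.lap
  have hs3 : tsupport (lap χ) ⊆ tsupport χ := closure_minimal (fun x hx => by
    by_contra h
    exact hx (lap_eq_zero_of_notMem_tsupport h)) isClosed_closure
  have hs3' : tsupport (fun x => lap χ x * v x) ⊆ tsupport χ :=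
    tsupport_mul_subset_left.trans hs3
  have hi3 : IntegrableOn (fun x => u x * (lap χ x * v x)) Ω :=
    hu.integrableOn_mul (contDiff_mul_of_tsupport hlap fun x hx => hvs x (hs3 hx)).continuous
      (hχc.of_isClosed_subset isClosed_closure hs3') (hs3'.trans hχΩ')
  have hae : ∀ᵐ x ∂volume.restrict Ω, x ∈ Ω ∧ x ≠ a :=
    (ae_restrict_mem hΩ.measurableSet).and (ae_restrict_of_ae (Measure.ae_ne volume a))
  have h1 := hu.distrib (fun x => χ x * v x) (contDiff_mul_of_tsupport hχ hvs) hχc.mul_right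
    (hsub.trans hχΩ')
  have h2 : ∫ x in Ω, u x * lap (fun x => χ x * v x) x =
      ∫ x in Ω, (2 * (u x * gradInner χ v x) + u x * (lap χ x * v x)) := by
    refine integral_congr_ae ?_
    filter_upwards [hae, ae_restrict_of_ae (hv.ae_lap_eq_zero hΩ)] with x hx h0
    by_cases hxχ : x ∈ tsupport χ
    · rw [lap_mul hχ.contDiffAt (hvs x hxχ), h0 (hχΩ hxχ)]
      ring
    · rw [lap_eq_zero_of_notMem_tsupport fun h => hxχ (hsub h),
        gradInner_eq_zero_of_notMem_tsupport hxχ, lap_eq_zero_of_notMem_tsupport hxχ]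
      ring
  have h3 : ∫ x in Ω, u x * (lap χ x * v x) =
      -∫ x in Ω, (u x * gradInner χ v x + v x * gradInner χ u x) := by
    have h4 := integral_mul_lap_left (f := fun x => u x * v x) hχ
      (fun i => hχc.mono' (tsupport_pd_subset χ i |>.trans' subset_closure))
      fun i x hx => (hu.contDiffAt_of_mem_tsupport_pd hχΩ' hχa i hx).mul
        (hvs x (tsupport_pd_subset χ i hx))
    rw [← setIntegral_eq_integral_of_tsupport hχΩ' fun x hx => by
        rw [lap_eq_zero_of_notMem_tsupport hx, zero_mul],
      ← setIntegral_eq_integral_of_tsupport hχΩ' fun x hx =>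
        gradInner_eq_zero_of_notMem_tsupport hx _] at h4
    simp only [mul_left_comm (u _)]
    rw [h4]
    congr 1
    refine integral_congr_ae ?_
    filter_upwards [hae] with x hx
    by_cases hxχ : x ∈ tsupport χ
    · rw [gradInner_comm, gradInner_mul_left (hu.smooth x hx.1 hx.2) (hvs x hxχ),
        gradInner_comm v, gradInner_comm u]
    · simp only [gradInner_eq_zero_of_notMem_tsupport hxχ, mul_zero, add_zero]
  rw [h2, integral_add (hi2.const_mul 2) hi3, integral_const_mul, h3, integral_add hi2 hi1,
    hχa.self_of_nhds] at h1
  linarith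

theorem gradInner_add_left (hu : ContDiff ℝ ∞ u) (hw : ContDiff ℝ ∞ w)
    (v : EuclideanSpace ℝ (Fin n) → ℝ) (x : EuclideanSpace ℝ (Fin n)) :
    gradInner (fun y => u y + w y) v x = gradInner u v x + gradInner w v x := by
  rw [gradInner, gradInner, gradInner, ← Finset.sum_add_distrib]
  refine Finset.sum_congr rfl fun i _ => ?_
  rw [pd_add (hu.contDiffAt.differentiableAt_of_infty) (hw.contDiffAt.differentiableAt_of_infty),
    add_mul]

theorem IsFundamentalSolution.eq_setIntegral_gradInner (hn : n ≠ 0) (hΩ : IsOpen Ω)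
    (hΩb : Bornology.IsBounded Ω) (hu : IsFundamentalSolution Ω u a)
    (hv : IsFundamentalSolution Ω v b) (hv0 : ∀ x ∉ Ω, Tendsto v (𝓝 x) (𝓝 0)) (ha : a ∈ Ω)
    (hb : b ∈ Ω) (hab : a ≠ b) (hint : IntegrableOn (gradInner u v) Ω) :
    v a = ∫ x in Ω, gradInner u v x := by
  obtain ⟨f, hf, hfc, hfΩ, hfa⟩ := exists_cutoff (hΩ.sdiff isClosed_singleton)
    (show a ∈ Ω \ {b} from ⟨ha, hab⟩)
  obtain ⟨g, hg, hgc, hgΩ, hgb⟩ := exists_cutoff (hΩ.sdiff isClosed_singleton)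
    (show b ∈ Ω \ {a} from ⟨hb, hab.symm⟩)
  have hfb : f =ᶠ[𝓝 b] 0 := notMem_tsupport_iff_eventuallyEq.1 fun h => (hfΩ h).2 rfl
  have hga : g =ᶠ[𝓝 a] 0 := notMem_tsupport_iff_eventuallyEq.1 fun h => (hgΩ h).2 rfl
  have hfΩ' := hfΩ.trans Set.sdiff_subset
  have hgΩ' := hgΩ.trans Set.sdiff_subset
  have hint' : IntegrableOn (gradInner v u) Ω := by
    simpa only [gradInner_comm v u, funext (gradInner_comm v u)] using hint
  have h1 := setIntegral_mul_gradInner_of_eventuallyEq_one hn hΩ hu hv ha hab hint hf hfc hfΩ hfa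
  have h2 := setIntegral_mul_gradInner_of_eventuallyEq_one hn hΩ hv hu hb hab.symm hint' hg hgc
    hgΩ hgb
  have h3 := setIntegral_one_sub_mul_gradInner hn hΩ hΩb hu hv hv0 hint' (hf.add hg) (hfc.add hgc)
    ((tsupport_add f g).trans (Set.union_subset hfΩ' hgΩ'))
    (by filter_upwards [hfa, hga] with x h h'; simp [h, h'])
    (by filter_upwards [hfb, hgb] with x h h'; simp [h, h'])
  have h4 := hu.eq_sub_setIntegral hn hΩ hv hf hfc hfΩ hfa
  have hbdd {χ : EuclideanSpace ℝ (Fin n) → ℝ} (hχ : ContDiff ℝ ∞ χ) (hχc : HasCompactSupport χ) :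
      IntegrableOn (fun x => χ x * gradInner v u x) Ω := by
    obtain ⟨M, hM⟩ := hχc.exists_bound_of_continuous hχ.continuous
    exact hint'.bdd_mul hχ.continuous.aestronglyMeasurable (Eventually.of_forall hM)
  have hs := tsupport_gradInner_subset g u
  have h5 : IntegrableOn (fun x => v x * gradInner g u x) Ω :=
    hv.integrableOn_mul (contDiff_gradInner_of_tsupport hg fun x hx =>
      hu.smooth x (hgΩ hx).1 (hgΩ hx).2).continuous
      (hgc.of_isClosed_subset isClosed_closure hs) (hs.trans hgΩ')
  have h6 : ∫ x in Ω, v x * gradInner (fun y => f y + g y) u x =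
      (∫ x in Ω, v x * gradInner f u x) + ∫ x in Ω, v x * gradInner g u x := by
    rw [← integral_add (hv.integrableOn_mul_gradInner hu hf hfc hfΩ' hfa) h5]
    refine integral_congr_ae (Eventually.of_forall fun x => ?_)
    simp only [gradInner_add_left hf hg, mul_add]
  have h7 : ∫ x in Ω, (1 - (f x + g x)) * gradInner v u x =
      (∫ x in Ω, gradInner v u x) - ((∫ x in Ω, f x * gradInner v u x) +
        ∫ x in Ω, g x * gradInner v u x) := by
    rw [← integral_add (hbdd hf hfc) (hbdd hg hgc)]
    refine Eq.trans ?_ (integral_sub hint' ((hbdd hf hfc).add (hbdd hg hgc)))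
    refine integral_congr_ae (Eventually.of_forall fun x => ?_)
    beta_reduce
    ring
  simp only [gradInner_comm u v] at h1 ⊢
  linarith

end Energy

namespace IsGreen

variable {n : ℕ} {Ω : Set (EuclideanSpace ℝ (Fin n))} {c x : EuclideanSpace ℝ (Fin n)}
  {G : EuclideanSpace ℝ (Fin n) → EuclideanSpace ℝ (Fin n) → ℝ}

theorem isFundamentalSolution_indicator (hG : IsGreen n Ω G) (hΩ : IsOpen Ω) (hc : c ∈ Ω) :
    IsFundamentalSolution Ω (Ω.indicator fun y => G y c) c where
  smooth x hx hxc :=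
    ((hG.smooth c hc).contDiffAt
      ((hΩ.sdiff isClosed_singleton).mem_nhds ⟨hx, hxc⟩)).congr_of_eventuallyEq
      (eventually_of_mem (hΩ.mem_nhds hx) fun _ hy => Set.indicator_of_mem hy _)
  locInt x hx := by
    obtain ⟨s, hs, h⟩ := hG.locInt c hc x hx
    exact ⟨s, hs, h.indicator hΩ.measurableSet⟩
  distrib φ hφ hφc hφΩ := by
    rw [← hG.distrib c hc φ hφ hφc hφΩ]
    refine setIntegral_congr_fun hΩ.measurableSet fun x hx => ?_
    simp only [Set.indicator_of_mem hx]

theorem tendsto_indicator (hG : IsGreen n Ω G) (hc : c ∈ Ω) (hx : x ∉ Ω) :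
    Tendsto (Ω.indicator fun y => G y c) (𝓝 x) (𝓝 0) := by
  have hxc : x ≠ c := fun h => hx (h ▸ hc)
  by_cases hxΩ : x ∈ closure Ω
  · obtain ⟨F, hF, hFG, hF0⟩ := hG.boundary c hc
    have h1 : Tendsto F (𝓝[Ω \ {c}] x) (𝓝 0) := by
      rw [← hF0 x ⟨hxΩ, fun h => hx (interior_subset h)⟩]
      exact (hF x ⟨hxΩ, hxc⟩).mono_left
        (nhdsWithin_mono x (Set.sdiff_subset_sdiff_left subset_closure))
    rw [tendsto_def] at h1 ⊢
    intro s hs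
    filter_upwards [mem_nhdsWithin_iff_eventually.1 (h1 s hs), isOpen_ne.mem_nhds hxc] with y hy hyc
    by_cases hyΩ : y ∈ Ω
    · simpa [Set.indicator_of_mem hyΩ, ← hFG y ⟨hyΩ, hyc⟩] using hy ⟨hyΩ, hyc⟩
    · simpa [Set.indicator_of_notMem hyΩ] using mem_of_mem_nhds hs
  · refine tendsto_const_nhds.congr' ?_
    filter_upwards [isClosed_closure.isOpen_compl.mem_nhds hxΩ] with y hy
    exact (Set.indicator_of_notMem (fun h => hy (subset_closure h)) _).symm

end IsGreen

/-- mutual-energy representation of the Green function: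
`G(a,b) = ∫_Ω ⟨∇G(·,a), ∇G(·,b)⟩`. -/
theorem green_eq_mutual_energy
    {n : ℕ} (hn : 2 ≤ n) (Ω : Set (EuclideanSpace ℝ (Fin n)))
    (hΩo : IsOpen Ω) (hΩb : Bornology.IsBounded Ω)
    (G : EuclideanSpace ℝ (Fin n) → EuclideanSpace ℝ (Fin n) → ℝ)
    (hG : IsGreen n Ω G)
    (a b : EuclideanSpace ℝ (Fin n)) (ha : a ∈ Ω) (hb : b ∈ Ω) (hab : a ≠ b)
    (hext : ∀ c ∈ ({a, b} : Set (EuclideanSpace ℝ (Fin n))),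
      ∃ F : EuclideanSpace ℝ (Fin n) → ℝ,
        ContDiffOn ℝ 1 F (closure Ω \ {c}) ∧ ∀ x ∈ Ω \ {c}, F x = G x c)
    (hint : IntegrableOn
      (fun x => ∑ i, pd (fun y => G y a) i x * pd (fun y => G y b) i x) Ω volume) :
    G a b = ∫ x in Ω, ∑ i, pd (fun y => G y a) i x * pd (fun y => G y b) i x := by
  have hn0 : n ≠ 0 := by omega
  have hpd {c x : EuclideanSpace ℝ (Fin n)} (hx : x ∈ Ω) :
      Ω.indicator (fun y => G y c) =ᶠ[𝓝 x] fun y => G y c :=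
    eventually_of_mem (hΩo.mem_nhds hx) fun y hy => Set.indicator_of_mem hy _
  have hgrad {x : EuclideanSpace ℝ (Fin n)} (hx : x ∈ Ω) :
      gradInner (Ω.indicator fun y => G y a) (Ω.indicator fun y => G y b) x =
        ∑ i, pd (fun y => G y a) i x * pd (fun y => G y b) i x := by
    rw [gradInner_congr_left (hpd hx), gradInner_congr_right (hpd hx), gradInner]
  have h := (hG.isFundamentalSolution_indicator hΩo ha).eq_setIntegral_gradInner hn0 hΩo hΩb
    (hG.isFundamentalSolution_indicator hΩo hb) (fun x hx => hG.tendsto_indicator hb hx) ha hb hab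
    (hint.congr_fun (fun x hx => (hgrad hx).symm) hΩo.measurableSet)
  rw [Set.indicator_of_mem ha] at h
  rw [h]
  exact setIntegral_congr_fun hΩo.measurableSet fun x hx => hgrad hx
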